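/- arXiv:1710.09959 — 2 statements merged into one kernel-verified Lean document; each statement's English description precedes it below -/
import Mathlib

section
/- Let B = diag(1,−1) act on row vectors by v ↦ v·B. Let 0 < θ < π/4 and let q be an action minimizer of A over P(Q_S, Q_{E₁}) that is differentiable from the left at t = 1 and has no collision at t = 1 (i.e., in the representation q(1) = ((−b₂₁,−a₂₁)R(θ), (−c₂₁,a₂₁)R(θ), (c₂₁,a₂₁)R(θ), (b₂₁,−a₂₁)R(θ)) one has b₂₁ > 0 and c₂₁ > 0). Then the first-variation conditions at t = 1 force the velocity relations q̇₁(1) = q̇₄(1)·B·R(2θ) and q̇₂(1) = q̇₃(1)·B·R(2θ). -/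
open Real MeasureTheory Set
open scoped ENNReal

noncomputable section

/-- Euclidean norm on `ℝ × ℝ` (row vectors in the plane). -/
def enorm2 (v : ℝ × ℝ) : ℝ := Real.sqrt (v.1 ^ 2 + v.2 ^ 2)

/-- Row vector multiplied on the right by the rotation matrix `R θ`
with rows `(cos θ, sin θ)` and `(-sin θ, cos θ)`. -/
def rotV (θ : ℝ) (v : ℝ × ℝ) : ℝ × ℝ :=
  (v.1 * Real.cos θ - v.2 * Real.sin θ, v.1 * Real.sin θ + v.2 * Real.cos θ)

/-- `H¹([0,1],(ℝ²)⁴)`: absolutely continuous paths `[0,1] → (ℝ²)⁴` with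
square-integrable derivative, recorded via an integrable (a.e.-)derivative `v`
together with the integral representation of `q`. -/
structure H1Path4 where
  q : ℝ → Fin 4 → ℝ × ℝ
  v : ℝ → Fin 4 → ℝ × ℝ
  hvInt : ∀ i : Fin 4, IntegrableOn (fun t => v t i) (Icc (0:ℝ) 1)
  hrep : ∀ i : Fin 4, ∀ t ∈ Icc (0:ℝ) 1, q t i = q 0 i + ∫ s in (0:ℝ)..t, v s i
  hL2 : ∀ i : Fin 4, IntegrableOn (fun t => enorm2 (v t i) ^ 2) (Icc (0:ℝ) 1)

/-- Center of mass at the origin throughout `[0,1]` (the path lies in `χ`). -/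
def H1Path4.inChi (p : H1Path4) : Prop := ∀ t ∈ Icc (0:ℝ) 1, ∑ i, p.q t i = 0

/-- The Lagrangian action functional `A`, with value `+∞` allowed. -/
def action (p : H1Path4) : ℝ≥0∞ :=
  ∫⁻ t in Icc (0:ℝ) 1,
    (ENNReal.ofReal ((1/2) * ∑ i, enorm2 (p.v t i) ^ 2)
      + ∑ i : Fin 4, ∑ j ∈ Finset.univ.filter (fun j => i < j),
          (ENNReal.ofReal (enorm2 (p.q t i - p.q t j)))⁻¹)

/-- The starting boundary configuration set `Q_S` (double isosceles with order
constraints). -/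
def QSset : Set (Fin 4 → ℝ × ℝ) :=
  { c | ∃ a₁ b₁ c₁ : ℝ, 0 ≤ b₁ ∧ 0 ≤ c₁ ∧
      c = ![(-a₁ - c₁, 0), (-a₁, 0), ((2*a₁ + c₁)/2, b₁), ((2*a₁ + c₁)/2, -b₁)] }

/-- The ending boundary configuration set `Q_{E₁}`. -/
def QE1set (θ : ℝ) : Set (Fin 4 → ℝ × ℝ) :=
  { c | ∃ a₂ b₂ c₂ : ℝ, 0 ≤ b₂ ∧ 0 ≤ c₂ ∧
      c = fun i => rotV θ (![(-b₂, -a₂), (-c₂, a₂), (c₂, a₂), (b₂, -a₂)] i) }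

/-- The ending boundary configuration set `Q_{E₂}`. -/
def QE2set (θ : ℝ) : Set (Fin 4 → ℝ × ℝ) :=
  { c | ∃ a₂ b₂ c₂ : ℝ, 0 ≤ b₂ ∧ 0 ≤ c₂ ∧
      c = fun i => rotV θ (![(-a₂, -b₂), (-a₂, b₂), (a₂, c₂), (a₂, -c₂)] i) }

/-- Membership in the admissible class `P(Q_S, E)`. -/
def inAdm (E : Set (Fin 4 → ℝ × ℝ)) (p : H1Path4) : Prop :=
  p.inChi ∧ p.q 0 ∈ QSset ∧ p.q 1 ∈ E

/-- `p` is an action minimizer over `P(Q_S, E)`. -/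
def isMin (E : Set (Fin 4 → ℝ × ℝ)) (p : H1Path4) : Prop :=
  inAdm E p ∧ ∀ p' : H1Path4, inAdm E p' → action p ≤ action p'

/-- The Newtonian equations of the equal-mass four-body problem, on a set `s`
of times. -/
def newton (Q : ℝ → Fin 4 → ℝ × ℝ) (s : Set ℝ) : Prop :=
  ∀ i : Fin 4, ∀ t ∈ s,
    deriv (deriv (fun u => Q u i)) t =
      ∑ j ∈ Finset.univ.erase i, (1 / enorm2 (Q t j - Q t i) ^ 3) • (Q t j - Q t i)
open Filter Topology

/-- The kinetic energy of four unit masses with velocities `v`. -/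
def kinetic (v : Fin 4 → ℝ × ℝ) : ℝ := (1/2) * ∑ i, enorm2 (v i) ^ 2

/-- The Newtonian potential of four unit masses, with value `∞` at collisions. -/
def potential (c : Fin 4 → ℝ × ℝ) : ℝ≥0∞ :=
  ∑ i : Fin 4, ∑ j ∈ Finset.univ.filter (fun j => i < j),
    (ENNReal.ofReal (enorm2 (c i - c j)))⁻¹

/-- The Euclidean pairing of two quadruples of plane vectors. -/
def pairing (v u : Fin 4 → ℝ × ℝ) : ℝ := ∑ i, ((v i).1 * (u i).1 + (v i).2 * (u i).2)

lemma enorm2_sq (v : ℝ × ℝ) : enorm2 v ^ 2 = v.1 ^ 2 + v.2 ^ 2 :=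
  Real.sq_sqrt (by positivity)

lemma continuous_enorm2 : Continuous enorm2 := by
  unfold enorm2
  fun_prop

lemma enorm2_pos {v : ℝ × ℝ} (hv : v ≠ 0) : 0 < enorm2 v := by
  refine Real.sqrt_pos.2 ?_
  by_contra! h
  have h1 : v.1 = 0 := by nlinarith [sq_nonneg v.1, sq_nonneg v.2]
  have h2 : v.2 = 0 := by nlinarith [sq_nonneg v.1, sq_nonneg v.2]
  exact hv (Prod.ext h1 h2)

lemma kinetic_nonneg (v : Fin 4 → ℝ × ℝ) : 0 ≤ kinetic v := by
  unfold kinetic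
  positivity

lemma kinetic_add_smul (v u : Fin 4 → ℝ × ℝ) (r : ℝ) :
    kinetic (v + r • u) = kinetic v + (r * pairing v u + r ^ 2 * kinetic u) := by
  simp only [kinetic, pairing, enorm2_sq, Fin.sum_univ_four, Pi.add_apply, Pi.smul_apply,
    Prod.fst_add, Prod.snd_add, Prod.smul_fst, Prod.smul_snd, smul_eq_mul]
  ring

lemma action_eq (p : H1Path4) :
    action p = ∫⁻ t in Icc (0:ℝ) 1, (ENNReal.ofReal (kinetic (p.v t)) + potential (p.q t)) :=
  rfl

lemma continuous_potential : Continuous potential := by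
  unfold potential
  refine continuous_finsetSum _ fun i _ => continuous_finsetSum _ fun j _ => ?_
  refine continuous_inv.comp (ENNReal.continuous_ofReal.comp ?_)
  exact continuous_enorm2.comp (by fun_prop)

lemma potential_ne_top {c : Fin 4 → ℝ × ℝ} (hc : ∀ i j, i < j → c i ≠ c j) :
    potential c ≠ ∞ := by
  unfold potential
  refine ENNReal.sum_ne_top.2 fun i _ => ENNReal.sum_ne_top.2 fun j hj => ?_
  rw [ENNReal.inv_ne_top, Ne, ENNReal.ofReal_eq_zero, not_le]
  exact enorm2_pos (sub_ne_zero.2 (hc i j (Finset.mem_filter.1 hj).2))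

lemma intervalIntegral_indicator_Ioi {E : Type*} [NormedAddCommGroup E] [NormedSpace ℝ E]
    [CompleteSpace E] {a t : ℝ} (ha : 0 ≤ a) (ht : 0 ≤ t) (x : E) :
    ∫ s in (0:ℝ)..t, (Ioi a).indicator (fun _ => x) s = max 0 (t - a) • x := by
  rw [intervalIntegral.integral_of_le ht, setIntegral_indicator measurableSet_Ioi,
    Ioc_inter_Ioi, sup_eq_right.2 ha, setIntegral_const, Real.volume_real_Ioc, max_comm]

lemma H1Path4.integrableOn_kinetic (p : H1Path4) :
    IntegrableOn (fun t => kinetic (p.v t)) (Icc (0:ℝ) 1) :=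
  (integrable_finsetSum _ fun i _ => p.hL2 i).const_mul _

lemma H1Path4.integrableOn_pairing (p : H1Path4) (u : Fin 4 → ℝ × ℝ) :
    IntegrableOn (fun t => pairing (p.v t) u) (Icc (0:ℝ) 1) :=
  integrable_finsetSum _ fun i _ =>
    ((p.hvInt i).fst.mul_const _).add ((p.hvInt i).snd.mul_const _)

lemma H1Path4.setIntegral_pairing (p : H1Path4) (u : Fin 4 → ℝ × ℝ) {a : ℝ} (ha : 0 ≤ a)
    (ha1 : a ≤ 1) :
    ∫ t in Ioc a 1, pairing (p.v t) u = pairing (p.q 1) u - pairing (p.q a) u := by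
  have hsub : Ioc a 1 ⊆ Icc (0:ℝ) 1 := fun t ht => ⟨ha.trans ht.1.le, ht.2⟩
  have hI : ∀ i, IntegrableOn (fun t => p.v t i) (Ioc a 1) := fun i => (p.hvInt i).mono_set hsub
  have hq : ∀ i, ∫ t in Ioc a 1, p.v t i = p.q 1 i - p.q a i := by
    intro i
    rw [p.hrep i 1 (by simp), p.hrep i a ⟨ha, ha1⟩, ← intervalIntegral.integral_of_le ha1,
      add_sub_add_left_eq_sub, intervalIntegral.integral_interval_sub_left]
    · exact (intervalIntegrable_iff_integrableOn_Ioc_of_le zero_le_one).2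
        ((p.hvInt i).mono_set Ioc_subset_Icc_self)
    · exact (intervalIntegrable_iff_integrableOn_Ioc_of_le ha).2
        ((p.hvInt i).mono_set (Ioc_subset_Icc_self.trans (Icc_subset_Icc_right ha1)))
  have h1 : ∀ i, ∫ t in Ioc a 1, (p.v t i).1 = (p.q 1 i).1 - (p.q a i).1 := fun i => by
    rw [← fst_integral (hI i), hq i, Prod.fst_sub]
  have h2 : ∀ i, ∫ t in Ioc a 1, (p.v t i).2 = (p.q 1 i).2 - (p.q a i).2 := fun i => by
    rw [← snd_integral (hI i), hq i, Prod.snd_sub]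
  unfold pairing
  have hsum : ∀ i, Integrable (fun t => (p.v t i).1 * (u i).1 + (p.v t i).2 * (u i).2)
      (volume.restrict (Ioc a 1)) := fun i =>
    ((hI i).fst.mul_const _).add ((hI i).snd.mul_const _)
  rw [integral_finsetSum _ fun i _ => hsum i, ← Finset.sum_sub_distrib]
  refine Finset.sum_congr rfl fun i _ => ?_
  rw [integral_add ((hI i).fst.mul_const _) ((hI i).snd.mul_const _), integral_mul_const,
    integral_mul_const, h1, h2]
  ring

/-- The path `p` with the displacement `r * max 0 (t - a)` in direction `u` added. -/
def H1Path4.perturb (p : H1Path4) (u : Fin 4 → ℝ × ℝ) (r a : ℝ) (ha : 0 ≤ a) : H1Path4 where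
  q t := p.q t + (r * max 0 (t - a)) • u
  v t := p.v t + (Ioi a).indicator (fun _ => r • u) t
  hvInt i := by
    have h : (fun t => (p.v t + (Ioi a).indicator (fun _ => r • u) t) i) =
        fun t => p.v t i + (Ioi a).indicator (fun _ => r • u i) t := by
      funext t
      by_cases ht : t ∈ Ioi a <;> simp [ht]
    rw [h]
    exact (p.hvInt i).add ((integrable_const _).indicator measurableSet_Ioi)
  hrep i t ht := by
    have h : (fun s => (p.v s + (Ioi a).indicator (fun _ => r • u) s) i) =
        fun s => p.v s i + (Ioi a).indicator (fun _ => r • u i) s := by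
      funext s
      by_cases hs : s ∈ Ioi a <;> simp [hs]
    have hIcc : Ioc 0 t ⊆ Icc (0:ℝ) 1 := fun s hs => ⟨hs.1.le, hs.2.trans ht.2⟩
    rw [h, intervalIntegral.integral_add, intervalIntegral_indicator_Ioi ha ht.1]
    · simp only [Pi.add_apply, Pi.smul_apply]
      rw [p.hrep i t ht, max_eq_left (by linarith : (0:ℝ) - a ≤ 0), mul_zero, zero_smul, add_zero,
        add_assoc, smul_smul, mul_comm r]
    · exact (intervalIntegrable_iff_integrableOn_Ioc_of_le ht.1).2 ((p.hvInt i).mono_set hIcc)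
    · exact (intervalIntegrable_iff_integrableOn_Ioc_of_le ht.1).2
        ((integrable_const _).indicator measurableSet_Ioi)
  hL2 i := by
    have h : (fun t => enorm2 ((p.v t + (Ioi a).indicator (fun _ => r • u) t) i) ^ 2) =
        fun t => enorm2 (p.v t i) ^ 2 + (Ioi a).indicator (fun t =>
          ((p.v t i).1 * (2 * r * (u i).1) + (p.v t i).2 * (2 * r * (u i).2))
            + r ^ 2 * enorm2 (u i) ^ 2) t := by
      funext t
      by_cases ht : t ∈ Ioi a
      · simp only [enorm2_sq, Pi.add_apply, indicator_of_mem ht, Pi.smul_apply,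
          Prod.fst_add, Prod.snd_add, Prod.smul_fst, Prod.smul_snd, smul_eq_mul]
        ring
      · simp [ht]
    rw [h]
    exact (p.hL2 i).add (((((p.hvInt i).fst.mul_const _).add
      ((p.hvInt i).snd.mul_const _)).add (integrable_const _)).indicator measurableSet_Ioi)

lemma H1Path4.kinetic_perturb (p : H1Path4) (u : Fin 4 → ℝ × ℝ) (r a : ℝ) (ha : 0 ≤ a) (t : ℝ) :
    kinetic ((p.perturb u r a ha).v t) = kinetic (p.v t) +
      (Ioi a).indicator (fun t => r * pairing (p.v t) u + r ^ 2 * kinetic u) t := by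
  by_cases ht : t ∈ Ioi a
  · simp only [perturb, indicator_of_mem ht, kinetic_add_smul]
  · simp [perturb, ht]

lemma H1Path4.integral_kinetic_perturb (p : H1Path4) (u : Fin 4 → ℝ × ℝ) (r : ℝ) {a : ℝ}
    (ha : 0 ≤ a) (ha1 : a ≤ 1) :
    ∫ t in Icc (0:ℝ) 1, kinetic ((p.perturb u r a ha).v t) =
      (∫ t in Icc (0:ℝ) 1, kinetic (p.v t)) +
        (r * (pairing (p.q 1) u - pairing (p.q a) u) + (1 - a) * (r ^ 2 * kinetic u)) := by
  have hI := (p.integrableOn_pairing u).const_mul r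
  have hI' : Integrable (fun t => r * pairing (p.v t) u + r ^ 2 * kinetic u)
      (volume.restrict (Icc (0:ℝ) 1)) := hI.add (integrable_const _)
  have hset : Icc (0:ℝ) 1 ∩ Ioi a = Ioc a 1 := by
    ext t
    simp only [mem_inter_iff, mem_Icc, mem_Ioi, mem_Ioc]
    exact ⟨fun h => ⟨h.2, h.1.2⟩, fun h => ⟨⟨ha.trans h.1.le, h.2⟩, h.1⟩⟩
  have hsub : Ioc a 1 ⊆ Icc (0:ℝ) 1 := hset ▸ inter_subset_left
  simp only [p.kinetic_perturb]
  rw [integral_add p.integrableOn_kinetic (hI'.indicator measurableSet_Ioi),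
    setIntegral_indicator measurableSet_Ioi, hset,
    integral_add (IntegrableOn.mono_set hI hsub) (integrable_const _), integral_const_mul,
    p.setIntegral_pairing u ha ha1, setIntegral_const, Real.volume_real_Ioc_of_le ha1, smul_eq_mul]

/-- If replacing `p` by a perturbed path raises the potential by at most `e` on `(a, 1]`, then
minimality bounds the kinetic terms from below. -/
lemma isMin.perturb_ineq {E : Set (Fin 4 → ℝ × ℝ)} {p : H1Path4} (hp : isMin E p)
    (hfin : action p ≠ ∞) {u : Fin 4 → ℝ × ℝ} (hu : ∑ i, u i = 0) {r a e : ℝ}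
    (ha : 0 ≤ a) (ha1 : a ≤ 1) (he : 0 ≤ e)
    (hE : p.q 1 + (r * (1 - a)) • u ∈ E)
    (hU : ∀ t ∈ Ioc a 1, potential (p.q t + (r * max 0 (t - a)) • u) ≤
      potential (p.q t) + ENNReal.ofReal e) :
    0 ≤ r * (pairing (p.q 1) u - pairing (p.q a) u) + (1 - a) * (r ^ 2 * kinetic u + e) := by
  set p' := p.perturb u r a ha with hp'
  have hadm : inAdm E p' := by
    refine ⟨fun t ht => ?_, ?_, ?_⟩
    · simp only [hp', H1Path4.perturb, Pi.add_apply, Pi.smul_apply, Finset.sum_add_distrib,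
        ← Finset.smul_sum, hu, hp.1.1 t ht, smul_zero, add_zero]
    · simpa [hp', H1Path4.perturb, ha] using hp.1.2.1
    · simpa [hp', H1Path4.perturb, ha1] using hE
  have hle := hp.2 p' hadm
  have hmeas : ∀ P : H1Path4, AEMeasurable (fun t => ENNReal.ofReal (kinetic (P.v t)))
      (volume.restrict (Icc (0:ℝ) 1)) := fun P =>
    P.integrableOn_kinetic.aestronglyMeasurable.aemeasurable.ennreal_ofReal
  have hkin : ∀ P : H1Path4, ∫⁻ t in Icc (0:ℝ) 1, ENNReal.ofReal (kinetic (P.v t)) =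
      ENNReal.ofReal (∫ t in Icc (0:ℝ) 1, kinetic (P.v t)) := fun P =>
    (ofReal_integral_eq_lintegral_ofReal P.integrableOn_kinetic
      (ae_of_all _ fun t => kinetic_nonneg _)).symm
  have hkn : ∀ P : H1Path4, 0 ≤ ∫ t in Icc (0:ℝ) 1, kinetic (P.v t) := fun P =>
    integral_nonneg fun t => kinetic_nonneg _
  have hpot : ∫⁻ t in Icc (0:ℝ) 1, potential (p'.q t) ≤
      (∫⁻ t in Icc (0:ℝ) 1, potential (p.q t)) + ENNReal.ofReal (e * (1 - a)) := by
    calc ∫⁻ t in Icc (0:ℝ) 1, potential (p'.q t)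
        ≤ ∫⁻ t in Icc (0:ℝ) 1, (potential (p.q t) +
            (Ioc a 1).indicator (fun _ => ENNReal.ofReal e) t) := by
          refine setLIntegral_mono' measurableSet_Icc fun t ht => ?_
          by_cases hta : t ∈ Ioc a 1
          · rw [indicator_of_mem hta]
            exact hU t hta
          · have : t - a ≤ 0 := by
              by_contra! h
              exact hta ⟨by linarith, ht.2⟩
            simp [hp', H1Path4.perturb, hta, this]
      _ ≤ _ := by
          rw [lintegral_add_right _ (measurable_const.indicator measurableSet_Ioc)]
          gcongr
          refine (setLIntegral_le_lintegral _ _).trans ?_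
          rw [lintegral_indicator measurableSet_Ioc, setLIntegral_const, Real.volume_Ioc,
            ENNReal.ofReal_mul he]
  rw [action_eq, action_eq, lintegral_add_left' (hmeas p), lintegral_add_left' (hmeas p')] at hle
  rw [action_eq, lintegral_add_left' (hmeas p)] at hfin
  have hpfin : ∫⁻ t in Icc (0:ℝ) 1, potential (p.q t) ≠ ∞ := (ENNReal.add_ne_top.1 hfin).2
  have h1 := hle.trans (add_le_add_right hpot _)
  rw [← add_assoc, add_right_comm] at h1
  have h2 := (ENNReal.add_le_add_iff_right hpfin).1 h1
  have hea : 0 ≤ e * (1 - a) := mul_nonneg he (by linarith)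
  rw [hkin, hkin, ← ENNReal.ofReal_add (hkn _) hea,
    ENNReal.ofReal_le_ofReal_iff (add_nonneg (hkn _) hea),
    p.integral_kinetic_perturb u r ha ha1] at h2
  linarith

lemma hasDerivWithinAt_pairing {Q : ℝ → Fin 4 → ℝ × ℝ} {w : Fin 4 → ℝ × ℝ} {s : Set ℝ} {x : ℝ}
    (hw : ∀ i, HasDerivWithinAt (fun t => Q t i) (w i) s x) (u : Fin 4 → ℝ × ℝ) :
    HasDerivWithinAt (fun t => pairing (Q t) u) (pairing w u) s x := by
  refine HasDerivWithinAt.fun_sum fun i _ => ?_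
  have h1 : HasDerivWithinAt (fun t => (Q t i).1) (w i).1 s x :=
    (ContinuousLinearMap.fst ℝ ℝ ℝ).hasFDerivAt.comp_hasDerivWithinAt x (hw i)
  have h2 : HasDerivWithinAt (fun t => (Q t i).2) (w i).2 s x :=
    (ContinuousLinearMap.snd ℝ ℝ ℝ).hasFDerivAt.comp_hasDerivWithinAt x (hw i)
  exact (h1.mul_const _).add (h2.mul_const _)

/-- First variation at the free endpoint: the final velocity of a minimizer is orthogonal to every
direction along which the terminal configuration can be moved inside the boundary set. -/
theorem isMin.pairing_eq_zero {E : Set (Fin 4 → ℝ × ℝ)} {p : H1Path4} (hp : isMin E p)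
    (hfin : action p ≠ ∞) (hpot : potential (p.q 1) ≠ ∞) {w : Fin 4 → ℝ × ℝ}
    (hw : ∀ i, HasDerivWithinAt (fun t => p.q t i) (w i) (Iic (1:ℝ)) 1)
    {u : Fin 4 → ℝ × ℝ} (hu : ∑ i, u i = 0)
    (hE : ∀ᶠ s : ℝ in 𝓝 0, p.q 1 + s • u ∈ E) : pairing w u = 0 := by
  have hq : Tendsto p.q (𝓝[≤] 1) (𝓝 (p.q 1)) :=
    tendsto_pi_nhds.2 fun i => (hw i).continuousWithinAt
  have key : ∀ r e : ℝ, 0 < e → 0 ≤ r * pairing w u + (r ^ 2 * kinetic u + e) := by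
    intro r e he
    have he2 : 0 < ENNReal.ofReal (e / 2) := ENNReal.ofReal_pos.2 (half_pos he)
    have hG : Tendsto (fun x : ℝ × ℝ => potential (p.q x.1 + x.2 • u)) (𝓝[≤] 1 ×ˢ 𝓝 0)
        (𝓝 (potential (p.q 1))) := by
      refine (continuous_potential.tendsto _).comp ?_
      have := (hq.comp tendsto_fst).add
        ((tendsto_snd (f := 𝓝[≤] (1:ℝ)) (g := 𝓝 (0:ℝ))).smul_const u)
      simpa using this
    obtain ⟨P, hP, S, hS, hPS⟩ := eventually_prod_iff.1 (ENNReal.tendsto_nhds hpot |>.1 hG _ he2)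
    obtain ⟨l, hl, hlP⟩ := (mem_nhdsLE_iff_exists_Ioc_subset).1 hP
    obtain ⟨d, hd, hdS⟩ := Metric.eventually_nhds_iff.1 hS
    obtain ⟨d', hd', hdE⟩ := Metric.eventually_nhds_iff.1 hE
    have hr : Tendsto (fun a : ℝ => |r| * (1 - a)) (𝓝[<] 1) (𝓝 0) := by
      have : Continuous fun a : ℝ => |r| * (1 - a) := by fun_prop
      simpa using (this.tendsto 1).mono_left nhdsWithin_le_nhds
    have hslope := (hasDerivWithinAt_iff_tendsto_slope.1 (hasDerivWithinAt_pairing hw u))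
    rw [Iic_sdiff_right] at hslope
    refine ge_of_tendsto ((hslope.const_mul r).add_const _) ?_
    filter_upwards [self_mem_nhdsWithin, hr.eventually_lt_const hd, hr.eventually_lt_const hd',
      mem_nhdsWithin_of_mem_nhds (lt_mem_nhds hl),
      mem_nhdsWithin_of_mem_nhds (lt_mem_nhds zero_lt_one)] with a ha1 had had' hal ha0
    have ha1 : a < 1 := ha1
    have habs : ∀ t ≤ 1, |r * max 0 (t - a)| ≤ |r| * (1 - a) := by
      intro t ht
      rw [abs_mul, abs_of_nonneg (a := max 0 (t - a)) (le_max_left _ _)]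
      exact mul_le_mul_of_nonneg_left (max_le (by linarith) (by linarith)) (abs_nonneg r)
    have := hp.perturb_ineq hfin hu (r := r) ha0.le ha1.le he.le (hdE ?_) fun t ht => ?_
    · rw [slope_def_field]
      have h1a : 0 < 1 - a := by linarith
      have heq : r * ((pairing (p.q a) u - pairing (p.q 1) u) / (a - 1)) +
          (r ^ 2 * kinetic u + e) = (r * (pairing (p.q 1) u - pairing (p.q a) u) +
            (1 - a) * (r ^ 2 * kinetic u + e)) / (1 - a) := by
        have : a - 1 ≠ 0 := by linarith
        field_simp
        ring
      rw [heq]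
      positivity
    · rw [Real.dist_0_eq_abs, abs_mul, abs_of_pos (by linarith : 0 < 1 - a)]
      exact had'
    · have htP : P t := hlP ⟨lt_trans hal ht.1, ht.2⟩
      have h1 := (hPS htP (hdS (y := r * max 0 (t - a))
        (by rw [Real.dist_0_eq_abs]; exact (habs t ht.2).trans_lt had))).2
      have h2 := (hPS htP (hdS (y := 0) (by simpa using hd))).1
      simp only [zero_smul, add_zero] at h2
      refine h1.trans ((add_le_add_left (tsub_le_iff_right.1 h2) _).trans ?_)
      rw [add_assoc, ← ENNReal.ofReal_add (by linarith) (by linarith), add_halves]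
  have key0 : ∀ r : ℝ, 0 ≤ r * pairing w u + r ^ 2 * kinetic u := fun r =>
    le_of_forall_pos_le_add fun e he => by linarith [key r e he]
  have hK := kinetic_nonneg u
  set D := pairing w u
  have h := key0 (-D / (kinetic u + 1))
  have heq : -D / (kinetic u + 1) * D + (-D / (kinetic u + 1)) ^ 2 * kinetic u =
      -(D / (kinetic u + 1)) ^ 2 := by
    field_simp
    ring
  rw [heq] at h
  have h0 : D / (kinetic u + 1) = 0 := by nlinarith [sq_nonneg (D / (kinetic u + 1))]
  exact (div_eq_zero_iff.1 h0).resolve_right (by linarith)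

/-- The path moving along the straight segment from `c` to `d`. -/
def H1Path4.segment (c d : Fin 4 → ℝ × ℝ) : H1Path4 where
  q t := c + t • (d - c)
  v _ := d - c
  hvInt i := integrable_const _
  hrep i t _ := by simp [smul_sub]
  hL2 i := integrable_const _

lemma H1Path4.action_segment_ne_top {c d : Fin 4 → ℝ × ℝ}
    (h : ∀ t ∈ Icc (0:ℝ) 1, ∀ i j, i < j → (c + t • (d - c)) i ≠ (c + t • (d - c)) j) :
    action (H1Path4.segment c d) ≠ ∞ := by
  have hcont : Continuous fun t : ℝ => potential (c + t • (d - c)) :=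
    continuous_potential.comp (by fun_prop)
  obtain ⟨t₀, ht₀, hmax⟩ := isCompact_Icc.exists_isMaxOn (nonempty_Icc.2 zero_le_one)
    hcont.continuousOn
  refine ne_top_of_le_ne_top ?_ (setLIntegral_mono' (g := fun _ =>
    ENNReal.ofReal (kinetic (d - c)) + potential (c + t₀ • (d - c))) measurableSet_Icc
    fun t ht => ?_)
  · rw [setLIntegral_const]
    refine ENNReal.mul_ne_top (ENNReal.add_ne_top.2 ⟨ENNReal.ofReal_ne_top, ?_⟩) (by simp)
    exact potential_ne_top (h t₀ ht₀)
  · exact add_le_add_right (hmax ht) _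

lemma exists_inAdm_QE1set_action_ne_top {θ : ℝ} (hθ0 : 0 < θ) (hθ1 : θ < π / 4) :
    ∃ p, inAdm (QE1set θ) p ∧ action p ≠ ∞ := by
  have hpi := Real.pi_pos
  have hs : 0 < Real.sin θ := Real.sin_pos_of_pos_of_lt_pi hθ0 (by linarith)
  have hsc : Real.sin θ < Real.cos θ := by
    rw [← Real.sin_pi_div_two_sub]
    exact Real.sin_lt_sin_of_lt_of_le_pi_div_two (by linarith) (by linarith) (by linarith)
  set c : Fin 4 → ℝ × ℝ := ![(-1 - 1, 0), (-1, 0), ((2*1 + 1)/2, 1), ((2*1 + 1)/2, -1)] with hc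
  set d : Fin 4 → ℝ × ℝ := ![rotV θ (-3, -1), rotV θ (-1, 1), rotV θ (1, 1), rotV θ (3, -1)] with hd
  refine ⟨H1Path4.segment c d, ⟨fun t _ => ?_, ?_, ?_⟩, H1Path4.action_segment_ne_top ?_⟩
  · ext <;> simp [H1Path4.segment, hc, hd, rotV, Fin.sum_univ_four] <;> ring
  · exact ⟨1, 1, 1, by norm_num, by norm_num, by simp [H1Path4.segment, hc]⟩
  · exact ⟨1, 3, 1, by norm_num, by norm_num, by
      funext i
      fin_cases i <;> simp [H1Path4.segment, hd]⟩
  · intro t ht i j hij h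
    obtain ⟨ht0, ht1⟩ := ht
    have hx := congrArg Prod.fst h
    have hy := congrArg Prod.snd h
    have h1 : 0 ≤ t * (Real.cos θ - Real.sin θ) := mul_nonneg ht0 (by linarith)
    have h2 : 0 ≤ t * Real.sin θ := mul_nonneg ht0 hs.le
    have h3 : 0 < (1 - t) + t * (Real.cos θ - Real.sin θ) := by
      rcases ht0.eq_or_lt with rfl | h0
      · norm_num
      · have := mul_pos h0 (sub_pos.2 hsc)
        linarith
    fin_cases i <;> fin_cases j <;>
      simp [hc, hd, rotV] at hij hx hy <;> nlinarith

lemma eventually_add_smul_mem_QE1set {θ a b c : ℝ} (hb : 0 < b) (hc : 0 < c) (x y z : ℝ) :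
    ∀ᶠ s : ℝ in 𝓝 0, (fun i => rotV θ (![(-b, -a), (-c, a), (c, a), (b, -a)] i)) +
      s • (fun i => rotV θ (![(-y, -x), (-z, x), (z, x), (y, -x)] i)) ∈ QE1set θ := by
  have hpos : ∀ {b : ℝ} (y : ℝ), 0 < b → ∀ᶠ s : ℝ in 𝓝 0, 0 < b + s * y := by
    intro b y hb
    have : Continuous fun s : ℝ => b + s * y := by fun_prop
    exact (this.tendsto 0).eventually_const_lt (by simpa using hb)
  filter_upwards [hpos y hb, hpos z hc] with s h1 h2
  refine ⟨a + s * x, b + s * y, c + s * z, h1.le, h2.le, ?_⟩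
  funext i
  fin_cases i <;> ext <;> simp [rotV] <;> ring

/-- the first-variation conditions at `t = 1` for a minimizer over
`P(Q_S, Q_{E₁})` without collision at `t = 1` force
`q̇₁(1) = q̇₄(1)·B·R(2θ)` and `q̇₂(1) = q̇₃(1)·B·R(2θ)`, where `B = diag(1,−1)`. -/
theorem statement8 (θ : ℝ) (hθ0 : 0 < θ) (hθ1 : θ < π/4)
    (p : H1Path4) (hp : isMin (QE1set θ) p)
    (w : Fin 4 → ℝ × ℝ)
    (hw : ∀ i : Fin 4, HasDerivWithinAt (fun t => p.q t i) (w i) (Iic (1:ℝ)) 1)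
    (hnc : ∀ i j : Fin 4, i ≠ j → p.q 1 i ≠ p.q 1 j) :
    w 0 = rotV (2*θ) ((w 3).1, -(w 3).2) ∧
    w 1 = rotV (2*θ) ((w 2).1, -(w 2).2) := by
  obtain ⟨p', hp', hfin'⟩ := exists_inAdm_QE1set_action_ne_top hθ0 hθ1
  have hfin : action p ≠ ∞ := ne_top_of_le_ne_top hfin' (hp.2 p' hp')
  have hpot : potential (p.q 1) ≠ ∞ := potential_ne_top fun i j hij => hnc i j hij.ne
  obtain ⟨a, b, c, hb, hc, hq⟩ := hp.1.2.2
  have hb : 0 < b := hb.lt_of_ne fun h => hnc 0 3 (by decide) (by rw [hq]; simp [← h])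
  have hc : 0 < c := hc.lt_of_ne fun h => hnc 1 2 (by decide) (by rw [hq]; simp [← h])
  have hvar : ∀ x y z : ℝ,
      pairing w (fun i => rotV θ (![(-y, -x), (-z, x), (z, x), (y, -x)] i)) = 0 := by
    intro x y z
    refine hp.pairing_eq_zero hfin hpot hw ?_ ?_
    · ext <;> simp [rotV, Fin.sum_univ_four] <;> ring
    · rw [hq]
      exact eventually_add_smul_mem_QE1set hb hc x y z
  have hsum : ∑ i, w i = 0 := by
    have h1 : HasDerivWithinAt (fun t => ∑ i, p.q t i) (∑ i, w i) (Icc 0 1) 1 :=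
      HasDerivWithinAt.fun_sum fun i _ => (hw i).mono Icc_subset_Iic_self
    have h2 : HasDerivWithinAt (fun t => ∑ i, p.q t i) 0 (Icc 0 1) 1 :=
      (hasDerivWithinAt_const _ _ (0 : ℝ × ℝ)).congr (fun t ht => hp.1.1 t ht)
        (hp.1.1 1 (by simp))
    exact (uniqueDiffOn_Icc zero_lt_one 1 (by simp)).eq_deriv _ h1 h2
  have hsx := congrArg Prod.fst hsum
  have hsy := congrArg Prod.snd hsum
  have hA := hvar 1 0 0
  have hB := hvar 0 1 0
  have hC := hvar 0 0 1
  simp [pairing, rotV, Fin.sum_univ_four] at hA hB hC hsx hsy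
  have hcs := Real.sin_sq_add_cos_sq θ
  simp only [rotV, Real.sin_two_mul, Real.cos_two_mul', Prod.ext_iff]
  have h03 : (w 0).2 * cos θ - (w 0).1 * sin θ + ((w 3).2 * cos θ - (w 3).1 * sin θ) = 0 := by
    linear_combination (-hA + cos θ * hsy - sin θ * hsx) / 2
  have h12 : (w 1).2 * cos θ - (w 1).1 * sin θ + ((w 2).2 * cos θ - (w 2).1 * sin θ) = 0 := by
    linear_combination (hA + cos θ * hsy - sin θ * hsx) / 2
  refine ⟨⟨?_, ?_⟩, ?_, ?_⟩
  · linear_combination (-cos θ) * hB - sin θ * h03 - (w 0).1 * hcs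
  · linear_combination (-sin θ) * hB + cos θ * h03 - (w 0).2 * hcs
  · linear_combination (-cos θ) * hC - sin θ * h12 - (w 1).1 * hcs
  · linear_combination (-sin θ) * hC + cos θ * h12 - (w 1).2 * hcs

end
end

section
/- Let θ ∈ (0, π], T > 0, μ > 0 and α > 0. Then the infimum of the Keplerian action functional I_{μ,α,T} over the class Γ_{T,θ} equals (3/2)·(μ·α²·θ²·T)^{1/3}, i.e. inf { I_{μ,α,T}(r) : r ∈ Γ_{T,θ} } = (3/2)(μα²θ²T)^{1/3}. -/
open Real MeasureTheory Set
open scoped ENNReal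

noncomputable section

/-- `H¹([0,T],ℝ²)`: absolutely continuous paths `[0,T] → ℝ²` with
square-integrable derivative, recorded via an integrable (a.e.-)derivative `v`
together with the integral representation of `r`. -/
structure H1PathK (T : ℝ) where
  r : ℝ → ℝ × ℝ
  v : ℝ → ℝ × ℝ
  hvInt : IntegrableOn v (Icc (0:ℝ) T)
  hrep : ∀ t ∈ Icc (0:ℝ) T, r t = r 0 + ∫ s in (0:ℝ)..t, v s
  hL2 : IntegrableOn (fun t => enorm2 (v t) ^ 2) (Icc (0:ℝ) T)

/-- The Keplerian action functional `I_{μ,α,T}`, with value `+∞` allowed. -/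
def keplerAction (mu alpha T : ℝ) (p : H1PathK T) : ℝ≥0∞ :=
  ∫⁻ t in Icc (0:ℝ) T,
    (ENNReal.ofReal (mu/2 * enorm2 (p.v t) ^ 2)
      + ENNReal.ofReal alpha * (ENNReal.ofReal (enorm2 (p.r t)))⁻¹)

/-- Membership in `Γ_{T,θ}`: the endpoints span an angle `θ`, i.e.
`⟨r(0), r(T)⟩ = |r(0)|·|r(T)|·cos θ`. -/
def inGamma (T θ : ℝ) (p : H1PathK T) : Prop :=
  (p.r 0).1 * (p.r T).1 + (p.r 0).2 * (p.r T).2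
    = enorm2 (p.r 0) * enorm2 (p.r T) * Real.cos θ

namespace KeplerAngle

open Filter Topology

lemma absolutelyContinuous_of_dist_le {f g h : ℝ → ℝ} {a b K : ℝ}
    (hf : AbsolutelyContinuousOnInterval f a b) (hg : AbsolutelyContinuousOnInterval g a b)
    (H : ∀ x ∈ uIcc a b, ∀ y ∈ uIcc a b,
      dist (h x) (h y) ≤ K * (dist (f x) (f y) + dist (g x) (g y))) :
    AbsolutelyContinuousOnInterval h a b := by
  have h0 := (Tendsto.add hf hg).const_mul K
  simp only [add_zero, mul_zero] at h0
  refine squeeze_zero' (Eventually.of_forall fun E => Finset.sum_nonneg fun i _ => dist_nonneg)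
    ?_ h0
  have hE : ∀ᶠ E in (AbsolutelyContinuousOnInterval.totalLengthFilter ⊓
      𝓟 (AbsolutelyContinuousOnInterval.disjWithin a b)),
      E ∈ AbsolutelyContinuousOnInterval.disjWithin a b :=
    mem_inf_of_right (mem_principal_self _)
  filter_upwards [hE] with E hE
  rw [← Finset.sum_add_distrib, Finset.mul_sum]
  refine Finset.sum_le_sum fun i hi => ?_
  exact H _ (hE.1 i hi).1 _ (hE.1 i hi).2

lemma absolutelyContinuous_comp {φ f : ℝ → ℝ} {a b c d : ℝ} (hφ : ContDiffOn ℝ 1 φ (Icc c d))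
    (hf : AbsolutelyContinuousOnInterval f a b) (hm : MapsTo f (uIcc a b) (Icc c d)) :
    AbsolutelyContinuousOnInterval (fun t => φ (f t)) a b := by
  obtain ⟨K, hK⟩ := hφ.exists_lipschitzOnWith (by decide) (convex_Icc _ _) isCompact_Icc
  refine absolutelyContinuous_of_dist_le (K := K) hf hf fun x hx y hy => ?_
  refine (hK.dist_le_mul _ (hm hx) _ (hm hy)).trans ?_
  gcongr
  exact le_add_of_nonneg_right dist_nonneg

lemma dist_sqrt_sq_add_sq_le (a b c d : ℝ) :
    dist (√(a ^ 2 + b ^ 2)) (√(c ^ 2 + d ^ 2)) ≤ dist a c + dist b d := by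
  have key : ∀ a b c d : ℝ, √(a ^ 2 + b ^ 2) ≤ √(c ^ 2 + d ^ 2) + (|a - c| + |b - d|) := by
    intro a b c d
    refine Real.sqrt_le_iff.2 ⟨by positivity, ?_⟩
    have hs := Real.sq_sqrt (by positivity : 0 ≤ c ^ 2 + d ^ 2)
    have hc : |c| ≤ √(c ^ 2 + d ^ 2) := Real.abs_le_sqrt (by nlinarith)
    have hd : |d| ≤ √(c ^ 2 + d ^ 2) := Real.abs_le_sqrt (by nlinarith)
    have e1 : a ^ 2 ≤ c ^ 2 + 2 * |c| * |a - c| + |a - c| ^ 2 := by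
      have := le_abs_self (c * (a - c))
      rw [abs_mul] at this
      rw [sq_abs]; nlinarith
    have e2 : b ^ 2 ≤ d ^ 2 + 2 * |d| * |b - d| + |b - d| ^ 2 := by
      have := le_abs_self (d * (b - d))
      rw [abs_mul] at this
      rw [sq_abs]; nlinarith
    have e3 := mul_le_mul_of_nonneg_right hc (abs_nonneg (a - c))
    have e4 := mul_le_mul_of_nonneg_right hd (abs_nonneg (b - d))
    nlinarith [mul_nonneg (abs_nonneg (a - c)) (abs_nonneg (b - d))]
  have h1 := key a b c d
  have h2 := key c d a b
  rw [abs_sub_comm c, abs_sub_comm d] at h2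
  rw [Real.dist_eq, Real.dist_eq, Real.dist_eq, abs_le]
  constructor <;> linarith

/-- Completing the square for the calibration in the frame rotating with angular speed `l / ρ`. -/
lemma calibration_le {X Y U W C D ρ l K g : ℝ} (hρ : 0 < ρ) (hXY : ρ ^ 2 = X ^ 2 + Y ^ 2)
    (hCD : C ^ 2 + D ^ 2 = 1) (hK : 4 * K ≤ l ^ 2) :
    l / 2 * (-U * D + W * C - l / ρ * (X * C + Y * D))
      + (g / 2 * ((X * U + Y * W) / ρ - (U * C + W * D + l / ρ * (-X * D + Y * C)))
        + -(g ^ 2 + (3 * l ^ 2 / 4 + K)) / ρ / 2 * (ρ - (X * C + Y * D)))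
      ≤ (U ^ 2 + W ^ 2) / 4 - K := by
  obtain ⟨c, hc⟩ : ∃ c, c = (X * C + Y * D) / ρ := ⟨_, rfl⟩
  obtain ⟨d, hd⟩ : ∃ d, d = (-X * D + Y * C) / ρ := ⟨_, rfl⟩
  obtain ⟨p, hp⟩ : ∃ p, p = U * C + W * D := ⟨_, rfl⟩
  obtain ⟨q, hq⟩ : ∃ q, q = -U * D + W * C := ⟨_, rfl⟩
  have hcd : c ^ 2 + d ^ 2 = 1 := by
    have : c ^ 2 + d ^ 2 = (X ^ 2 + Y ^ 2) * (C ^ 2 + D ^ 2) / ρ ^ 2 := by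
      rw [hc, hd]; ring
    rw [this, hCD, ← hXY]; field_simp
  have hpq : U ^ 2 + W ^ 2 = p ^ 2 + q ^ 2 := by
    have : p ^ 2 + q ^ 2 = (U ^ 2 + W ^ 2) * (C ^ 2 + D ^ 2) := by rw [hp, hq]; ring
    rw [this, hCD, mul_one]
  have hrad : (X * U + Y * W) / ρ = c * p + d * q := by
    have : c * p + d * q = (X * U + Y * W) * (C ^ 2 + D ^ 2) / ρ := by
      rw [hc, hd, hp, hq]; ring
    rw [this, hCD, mul_one]
  have hX : X * C + Y * D = ρ * c := by rw [hc]; field_simp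
  have hY : -X * D + Y * C = ρ * d := by rw [hd]; field_simp
  have hc1 : -1 ≤ c := by nlinarith [sq_nonneg d]
  rw [hX, hY, hrad, hpq, ← hp, ← hq]
  have e1 : l / ρ * (ρ * c) = l * c := by field_simp
  have e2 : l / ρ * (ρ * d) = l * d := by field_simp
  have e3 : -(g ^ 2 + (3 * l ^ 2 / 4 + K)) / ρ / 2 * (ρ - ρ * c)
      = -(g ^ 2 + (3 * l ^ 2 / 4 + K)) / 2 * (1 - c) := by field_simp
  rw [e1, e2, e3]
  have h0 : 0 ≤ (l ^ 2 / 8 - K / 2) * (1 + c) := mul_nonneg (by linarith) (by linarith)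
  have h1 : (p ^ 2 + q ^ 2) / 4 - K - (l / 2 * (q - l * c) + (g / 2 * (c * p + d * q - (p + l * d))
      + -(g ^ 2 + (3 * l ^ 2 / 4 + K)) / 2 * (1 - c)))
      = (p / 2 - g / 2 * (c - 1)) ^ 2 + (q / 2 - (l / 2 + g / 2 * d)) ^ 2
        + (l ^ 2 / 8 - K / 2) * (1 + c) - g ^ 2 / 4 * (c ^ 2 + d ^ 2 - 1) := by ring
  rw [hcd] at h1
  nlinarith [sq_nonneg (p / 2 - g / 2 * (c - 1)), sq_nonneg (q / 2 - (l / 2 + g / 2 * d))]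

/-- Two planar vectors at angle `θ` are, up to orientation, given by polar angles `φ`, `φ ± θ`. -/
lemma exists_polar_of_inner_eq {a b c d θ : ℝ}
    (h : a * c + b * d = √(a ^ 2 + b ^ 2) * √(c ^ 2 + d ^ 2) * cos θ) :
    ∃ φ σ : ℝ, σ ^ 2 = 1 ∧ a = √(a ^ 2 + b ^ 2) * cos φ ∧ b = √(a ^ 2 + b ^ 2) * sin φ ∧
      c = √(c ^ 2 + d ^ 2) * cos (σ * θ + φ) ∧ d = √(c ^ 2 + d ^ 2) * sin (σ * θ + φ) := by
  have polar : ∀ a b : ℝ, ∃ φ, a = √(a ^ 2 + b ^ 2) * cos φ ∧ b = √(a ^ 2 + b ^ 2) * sin φ := by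
    intro a b
    have hn : ‖(⟨a, b⟩ : ℂ)‖ = √(a ^ 2 + b ^ 2) := by
      rw [Complex.norm_def, Complex.normSq_mk]; ring_nf
    refine ⟨Complex.arg ⟨a, b⟩, ?_, ?_⟩
    · rw [← hn, Complex.norm_mul_cos_arg]
    · rw [← hn, Complex.norm_mul_sin_arg]
  obtain ⟨φ, ha, hb⟩ := polar a b
  obtain ⟨ψ, hc, hd⟩ := polar c d
  set m := √(a ^ 2 + b ^ 2)
  set n := √(c ^ 2 + d ^ 2)
  by_cases hm : m = 0
  · refine ⟨ψ - θ, 1, by norm_num, by rw [ha, hm]; simp, by rw [hb, hm]; simp, ?_, ?_⟩ <;>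
      simpa using by assumption
  by_cases hn : n = 0
  · refine ⟨φ, 1, by norm_num, ha, hb, by rw [hc, hn]; simp, by rw [hd, hn]; simp⟩
  have hcos : cos (ψ - φ) = cos θ := by
    have : m * n * cos (ψ - φ) = m * n * cos θ := by
      rw [← h, cos_sub]
      conv_rhs => rw [ha, hb, hc, hd]
      ring
    exact mul_left_cancel₀ (mul_ne_zero hm hn) this
  obtain ⟨k, hk⟩ := Real.cos_eq_cos_iff.1 hcos
  rcases hk with hk | hk
  · refine ⟨φ, 1, by norm_num, ha, hb, ?_⟩
    have : 1 * θ + φ = ψ + k * (2 * π) := by linarith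
    rw [this, Real.cos_add_int_mul_two_pi, Real.sin_add_int_mul_two_pi]
    exact ⟨hc, hd⟩
  · refine ⟨φ, -1, by norm_num, ha, hb, ?_⟩
    have : -1 * θ + φ = ψ - k * (2 * π) := by linarith
    rw [this, Real.cos_sub_int_mul_two_pi, Real.sin_sub_int_mul_two_pi]
    exact ⟨hc, hd⟩

/-- The sharp inequality `θ² T ≤ (∫ 1/|r|)² ∫ |ṙ|²` for paths whose endpoints span the angle
`θ ≤ π`, collisions being allowed. -/
lemma angle_sq_mul_le {θ T x₀ y₀ : ℝ} (hθ0 : 0 < θ) (hθ1 : θ ≤ π) (hT : 0 < T) {u w x y ρ : ℝ → ℝ}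
    (hu : IntervalIntegrable u volume 0 T) (hw : IntervalIntegrable w volume 0 T)
    (huw : IntervalIntegrable (fun t => u t ^ 2 + w t ^ 2) volume 0 T)
    (hx : ∀ t, x t = x₀ + ∫ s in (0:ℝ)..t, u s) (hy : ∀ t, y t = y₀ + ∫ s in (0:ℝ)..t, w s)
    (hρ : ∀ t, ρ t = √(x t ^ 2 + y t ^ 2))
    (hinv : IntervalIntegrable (fun t => (ρ t)⁻¹) volume 0 T)
    (hne : ∀ᵐ t, t ∈ uIcc 0 T → ρ t ≠ 0)
    (hang : x 0 * x T + y 0 * y T = ρ 0 * ρ T * cos θ) :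
    θ ^ 2 * T ≤ (∫ t in (0:ℝ)..T, (ρ t)⁻¹) ^ 2 * ∫ t in (0:ℝ)..T, (u t ^ 2 + w t ^ 2) := by
  have hρ0 : ∀ t, 0 ≤ ρ t := fun t => by rw [hρ]; positivity
  set S := ∫ t in (0:ℝ)..T, (ρ t)⁻¹ with hS
  set s : ℝ → ℝ := fun t => ∫ τ in (0:ℝ)..t, (ρ τ)⁻¹ with hs
  have h0mem : (0:ℝ) ∈ uIcc 0 T := left_mem_uIcc
  have sAC : AbsolutelyContinuousOnInterval s 0 T :=
    hinv.absolutelyContinuousOnInterval_intervalIntegral h0mem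
  have primitiveAC : ∀ {f z : ℝ → ℝ} {z₀ : ℝ}, IntervalIntegrable f volume 0 T →
      (∀ t, z t = z₀ + ∫ s in (0:ℝ)..t, f s) → AbsolutelyContinuousOnInterval z 0 T := by
    intro f z z₀ hf hz
    refine absolutelyContinuous_of_dist_le (K := 1)
      (hf.absolutelyContinuousOnInterval_intervalIntegral h0mem)
      (hf.absolutelyContinuousOnInterval_intervalIntegral h0mem) fun a _ b _ => ?_
    rw [hz, hz, dist_add_left, one_mul]
    exact le_add_of_nonneg_right dist_nonneg
  have xAC := primitiveAC hu hx
  have yAC := primitiveAC hw hy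
  have ρAC : AbsolutelyContinuousOnInterval ρ 0 T :=
    absolutelyContinuous_of_dist_le (K := 1) xAC yAC fun a _ b _ => by
      rw [hρ, hρ, one_mul]; exact dist_sqrt_sq_add_sq_le _ _ _ _
  have hspos : 0 < S := by
    rw [hS]
    have hae : ∀ᵐ t ∂volume.restrict (Ioc 0 T), 0 < (ρ t)⁻¹ := by
      rw [ae_restrict_iff' measurableSet_Ioc]
      filter_upwards [hne] with t ht hmem
      have := ht (by rw [uIcc_of_le hT.le]; exact Ioc_subset_Icc_self hmem)
      exact inv_pos.2 (lt_of_le_of_ne (hρ0 t) this.symm)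
    have hi := (intervalIntegrable_iff_integrableOn_Ioc_of_le hT.le).1 hinv
    rw [intervalIntegral.integral_of_le hT.le]
    refine lt_of_le_of_ne (integral_nonneg fun t => inv_nonneg.2 (hρ0 t)) fun h0 => ?_
    have hz := (integral_eq_zero_iff_of_nonneg (fun t => inv_nonneg.2 (hρ0 t)) hi).1 h0.symm
    have hF : ∀ᵐ t ∂volume.restrict (Ioc 0 T), False := by
      filter_upwards [hae, hz] with t h1 h2
      simp only [Pi.zero_apply] at h2
      linarith
    rw [ae_restrict_iff' measurableSet_Ioc] at hF
    have : volume (Ioc 0 T) = 0 := by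
      rw [measure_eq_zero_iff_ae_notMem]; exact hF
    simp [hT.not_ge] at this
  have hsmem : ∀ t ∈ uIcc 0 T, s t ∈ Icc 0 S := by
    intro t ht
    rw [uIcc_of_le hT.le] at ht
    refine ⟨intervalIntegral.integral_nonneg ht.1 fun τ _ => inv_nonneg.2 (hρ0 τ), ?_⟩
    exact intervalIntegral.integral_mono_interval le_rfl ht.1 ht.2
      (Eventually.of_forall fun τ => inv_nonneg.2 (hρ0 τ)) hinv
  have hs0 : s 0 = 0 := by simp [hs]
  have hsT : s T = S := rfl
  rw [hρ, hρ] at hang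
  obtain ⟨φ, σ, hσ, hx0, hy0, hxT, hyT⟩ := exists_polar_of_inner_eq hang
  rw [← hρ] at hx0 hy0 hxT hyT
  obtain ⟨l, hl⟩ : ∃ l, l = σ * θ / S := ⟨_, rfl⟩
  have hl2 : l ^ 2 = θ ^ 2 / S ^ 2 := by rw [hl, div_pow, mul_pow, hσ, one_mul]
  have hl2pos : 0 < l ^ 2 := by rw [hl2]; positivity
  have hlS : l * S = σ * θ := by rw [hl]; field_simp
  have main : ∀ K, 0 ≤ K → K < l ^ 2 / 4 →
      K ≤ (∫ t in (0:ℝ)..T, (u t ^ 2 + w t ^ 2)) / 4 / T := by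
    intro K hK0 hK
    obtain ⟨κ, hκ⟩ : ∃ κ, κ = √(3 * l ^ 2 / 4 + K) := ⟨_, rfl⟩
    have hκ2 : κ ^ 2 = 3 * l ^ 2 / 4 + K := by rw [hκ, Real.sq_sqrt (by positivity)]
    have hκpos : 0 < κ := by rw [hκ]; positivity
    have hκS : κ * S < π := by
      refine lt_of_lt_of_le (lt_of_pow_lt_pow_left₀ 2 hθ0.le ?_) hθ1
      have : θ ^ 2 = l ^ 2 * S ^ 2 := by rw [hl2]; field_simp
      rw [this, mul_pow]
      have : 0 < S ^ 2 := by positivity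
      nlinarith
    obtain ⟨δ, hδ⟩ : ∃ δ, δ = (π - κ * S) / 2 := ⟨_, rfl⟩
    have hsin : ∀ z ∈ Icc 0 S, sin (κ * z + δ) ≠ 0 := by
      intro z hz
      have h1 : 0 ≤ κ * z := mul_nonneg hκpos.le hz.1
      have h2 : κ * z ≤ κ * S := mul_le_mul_of_nonneg_left hz.2 hκpos.le
      exact (Real.sin_pos_of_pos_of_lt_pi (by linarith) (by linarith)).ne'
    set g : ℝ → ℝ := fun z => κ * (cos (κ * z + δ) / sin (κ * z + δ)) with hg
    have gC : ContDiffOn ℝ 1 g (Icc 0 S) := by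
      refine contDiffOn_const.mul (ContDiffOn.div ?_ ?_ hsin)
      · exact ContDiff.contDiffOn (by fun_prop)
      · exact ContDiff.contDiffOn (by fun_prop)
    have gD : ∀ z ∈ Icc 0 S, HasDerivAt g (-(g z ^ 2 + (3 * l ^ 2 / 4 + K))) z := by
      intro z hz
      have hlin : HasDerivAt (fun z => κ * z + δ) κ z := by
        simpa using ((hasDerivAt_id z).const_mul κ).add_const δ
      have := ((hlin.cos).div (hlin.sin) (hsin z hz)).const_mul κ
      refine this.congr_deriv ?_
      have hsz := hsin z hz
      rw [← hκ2]
      simp only [hg]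
      field_simp
      ring
    have gAC : AbsolutelyContinuousOnInterval (fun t => g (s t)) 0 T :=
      absolutelyContinuous_comp gC sAC hsmem
    have cAC : AbsolutelyContinuousOnInterval (fun t => cos (l * s t + φ)) 0 T :=
      absolutelyContinuous_comp (φ := fun z => cos (l * z + φ))
        (ContDiff.contDiffOn (by fun_prop)) sAC hsmem
    have dAC : AbsolutelyContinuousOnInterval (fun t => sin (l * s t + φ)) 0 T :=
      absolutelyContinuous_comp (φ := fun z => sin (l * z + φ))
        (ContDiff.contDiffOn (by fun_prop)) sAC hsmem
    set G : ℝ → ℝ := fun t =>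
      l / 2 * (-x t * sin (l * s t + φ) + y t * cos (l * s t + φ))
        + 1 / 2 * g (s t) * (ρ t - (x t * cos (l * s t + φ) + y t * sin (l * s t + φ))) with hG
    have GAC : AbsolutelyContinuousOnInterval G 0 T := by
      have h1 := ((xAC.neg.fun_mul dAC).add (yAC.fun_mul cAC)).const_mul (l / 2)
      have h2 := (gAC.const_mul (1 / 2)).fun_mul
        (ρAC.sub ((xAC.fun_mul cAC).add (yAC.fun_mul dAC)))
      exact h1.add h2
    have G0 : G 0 = 0 := by
      simp only [hG, hs0, mul_zero, zero_add]
      rw [hx0, hy0]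
      linear_combination -(g 0 / 2 * ρ 0) * (Real.sin_sq_add_cos_sq φ)
    have GT : G T = 0 := by
      simp only [hG, hsT, hlS]
      rw [hxT, hyT]
      linear_combination -(g S / 2 * ρ T) * (Real.sin_sq_add_cos_sq (σ * θ + φ))
    have hderiv : ∀ᵐ t, t ∈ uIcc 0 T → deriv G t ≤ (u t ^ 2 + w t ^ 2) / 4 - K := by
      filter_upwards [hne, hu.ae_hasDerivAt_integral, hw.ae_hasDerivAt_integral,
        hinv.ae_hasDerivAt_integral] with t htne htu htw hts htm
      have hρt : 0 < ρ t := lt_of_le_of_ne (hρ0 t) (htne htm).symm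
      have hρsq : ρ t ^ 2 = x t ^ 2 + y t ^ 2 := by rw [hρ, Real.sq_sqrt (by positivity)]
      have dx : HasDerivAt x (u t) t := by
        rw [funext hx]; exact (htu htm 0 h0mem).const_add x₀
      have dy : HasDerivAt y (w t) t := by
        rw [funext hy]; exact (htw htm 0 h0mem).const_add y₀
      have ds : HasDerivAt s (ρ t)⁻¹ t := hts htm 0 h0mem
      have dρ : HasDerivAt ρ ((x t * u t + y t * w t) / ρ t) t := by
        rw [funext hρ]
        have := ((dx.pow 2).add (dy.pow 2)).sqrt (by
          simp only [Pi.add_apply, Pi.pow_apply]; rw [← hρsq]; positivity)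
        refine this.congr_deriv ?_
        simp only [Pi.add_apply, Pi.pow_apply]
        field_simp
        ring
      have da : HasDerivAt (fun t => l * s t + φ) (l * (ρ t)⁻¹) t :=
        (ds.const_mul l).add_const φ
      have dg : HasDerivAt (fun t => g (s t))
          (-(g (s t) ^ 2 + (3 * l ^ 2 / 4 + K)) * (ρ t)⁻¹) t :=
        (gD _ (hsmem t htm)).comp t ds
      have dG := (((dx.neg.mul da.sin).add (dy.mul da.cos)).const_mul (l / 2)).add
        ((dg.const_mul (1 / 2)).mul (dρ.sub ((dx.mul da.cos).add (dy.mul da.sin))))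
      have hle := calibration_le (U := u t) (W := w t) (g := g (s t)) (l := l) (K := K) hρt hρsq
        (by rw [add_comm]; exact Real.sin_sq_add_cos_sq (l * s t + φ) :
          cos (l * s t + φ) ^ 2 + sin (l * s t + φ) ^ 2 = 1) (by linarith)
      have hd : deriv G t = _ := dG.deriv
      rw [hd]
      refine le_trans (le_of_eq ?_) hle
      simp only [Pi.add_apply, Pi.sub_apply, Pi.neg_apply, Pi.mul_apply, div_eq_mul_inv]
      ring
    have hint := GAC.integral_deriv_eq_sub
    rw [G0, GT, sub_zero] at hint
    have hR : IntervalIntegrable (fun t => (u t ^ 2 + w t ^ 2) / 4 - K) volume 0 T :=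
      (huw.div_const 4).sub intervalIntegrable_const
    have hmono := intervalIntegral.integral_mono_ae_restrict hT.le
      GAC.intervalIntegrable_deriv hR (by
        rw [Filter.EventuallyLE, ae_restrict_iff' measurableSet_Icc]
        rw [uIcc_of_le hT.le] at hderiv
        exact hderiv)
    rw [hint, intervalIntegral.integral_sub (huw.div_const 4) intervalIntegrable_const,
      intervalIntegral.integral_div, intervalIntegral.integral_const] at hmono
    rw [le_div_iff₀ hT]
    simp only [sub_zero, smul_eq_mul] at hmono
    linarith
  have hfin : l ^ 2 / 4 ≤ (∫ t in (0:ℝ)..T, (u t ^ 2 + w t ^ 2)) / 4 / T := by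
    refine le_of_forall_lt_imp_le_of_dense fun K hK => ?_
    exact (le_max_left K 0).trans (main _ (le_max_right K 0) (max_lt hK (by positivity)))
  rw [hl2, le_div_iff₀ hT] at hfin
  have : θ ^ 2 * T = S ^ 2 * (4 * (θ ^ 2 / S ^ 2 / 4 * T)) := by field_simp
  rw [this]
  gcongr
  linarith
lemma enorm2_sq (v : ℝ × ℝ) : enorm2 v ^ 2 = v.1 ^ 2 + v.2 ^ 2 := by
  rw [enorm2, Real.sq_sqrt (by positivity)]

lemma le_keplerAction {θ T mu alpha : ℝ} (hθ0 : 0 < θ) (hθ1 : θ ≤ π)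
    (hT : 0 < T) (hmu : 0 < mu) (halpha : 0 < alpha) (p : H1PathK T) (hp : inGamma T θ p) :
    ENNReal.ofReal ((3/2) * (mu * alpha^2 * θ^2 * T) ^ ((1:ℝ)/3)) ≤ keplerAction mu alpha T p := by
  by_cases htop : keplerAction mu alpha T p = ⊤
  · rw [htop]; exact le_top
  have h0mem : (0:ℝ) ∈ Icc 0 T := left_mem_Icc.2 hT.le
  have hTmem : T ∈ Icc 0 T := right_mem_Icc.2 hT.le
  have hv : IntervalIntegrable p.v volume 0 T :=
    (intervalIntegrable_iff_integrableOn_Icc_of_le hT.le).2 p.hvInt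
  have hu : IntervalIntegrable (fun t => (p.v t).1) volume 0 T :=
    (intervalIntegrable_iff_integrableOn_Icc_of_le hT.le).2 p.hvInt.fst
  have hw : IntervalIntegrable (fun t => (p.v t).2) volume 0 T :=
    (intervalIntegrable_iff_integrableOn_Icc_of_le hT.le).2 p.hvInt.snd
  set x : ℝ → ℝ := fun t => (p.r 0).1 + ∫ s in (0:ℝ)..t, (p.v s).1 with hx
  set y : ℝ → ℝ := fun t => (p.r 0).2 + ∫ s in (0:ℝ)..t, (p.v s).2 with hy
  set ρ : ℝ → ℝ := fun t => √(x t ^ 2 + y t ^ 2) with hρ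
  have hr : ∀ t ∈ Icc 0 T, p.r t = (x t, y t) := by
    intro t ht
    have hvt : IntervalIntegrable p.v volume 0 t :=
      hv.mono_set (by rw [uIcc_of_le ht.1, uIcc_of_le hT.le]; exact Icc_subset_Icc_right ht.2)
    have h1 := (ContinuousLinearMap.fst ℝ ℝ ℝ).intervalIntegral_comp_comm hvt
    have h2 := (ContinuousLinearMap.snd ℝ ℝ ℝ).intervalIntegral_comp_comm hvt
    simp only [ContinuousLinearMap.coe_fst', ContinuousLinearMap.coe_snd'] at h1 h2
    rw [p.hrep t ht]
    ext
    · simp only [hx, h1, Prod.fst_add]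
    · simp only [hy, h2, Prod.snd_add]
  have hrρ : ∀ t ∈ Icc 0 T, enorm2 (p.r t) = ρ t := fun t ht => by rw [hr t ht]; rfl
  have hxc : ContinuousOn x (Icc 0 T) :=
    continuousOn_const.add (intervalIntegral.continuousOn_primitive_interval' hu
      left_mem_uIcc |>.mono (uIcc_of_le hT.le).ge)
  have hyc : ContinuousOn y (Icc 0 T) :=
    continuousOn_const.add (intervalIntegral.continuousOn_primitive_interval' hw
      left_mem_uIcc |>.mono (uIcc_of_le hT.le).ge)
  have hρc : ContinuousOn ρ (Icc 0 T) := ((hxc.pow 2).add (hyc.pow 2)).sqrt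
  have hρm : AEMeasurable ρ (volume.restrict (Icc 0 T)) := hρc.aemeasurable measurableSet_Icc
  have hsq : IntegrableOn (fun t => mu / 2 * enorm2 (p.v t) ^ 2) (Icc 0 T) := p.hL2.const_mul _
  have hsplit : keplerAction mu alpha T p =
      ENNReal.ofReal (∫ t in Icc 0 T, mu / 2 * enorm2 (p.v t) ^ 2)
        + ENNReal.ofReal alpha * ∫⁻ t in Icc 0 T, (ENNReal.ofReal (ρ t))⁻¹ := by
    rw [keplerAction, lintegral_add_left' hsq.aemeasurable.ennreal_ofReal,
      lintegral_const_mul' _ _ ENNReal.ofReal_ne_top,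
      ofReal_integral_eq_lintegral_ofReal hsq (Filter.Eventually.of_forall fun t => by positivity)]
    congr 2
    refine setLIntegral_congr_fun measurableSet_Icc fun t ht => ?_
    simp only [hrρ t ht]
  have hLtop : ∫⁻ t in Icc 0 T, (ENNReal.ofReal (ρ t))⁻¹ ≠ ⊤ := by
    intro h
    rw [hsplit, h, ENNReal.mul_top (by simpa using halpha)] at htop
    simp at htop
  have hpos : ∀ᵐ t ∂volume.restrict (Icc 0 T), 0 < ρ t := by
    filter_upwards [ae_lt_top' hρm.ennreal_ofReal.inv hLtop] with t ht
    simpa [ENNReal.inv_lt_top] using ht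
  have hLeq : ∫⁻ t in Icc 0 T, (ENNReal.ofReal (ρ t))⁻¹
      = ∫⁻ t in Icc 0 T, ENNReal.ofReal (ρ t)⁻¹ := by
    refine lintegral_congr_ae ?_
    filter_upwards [hpos] with t ht
    exact (ENNReal.ofReal_inv_of_pos ht).symm
  have hinvnn : 0 ≤ᵐ[volume.restrict (Icc 0 T)] fun t => (ρ t)⁻¹ :=
    Filter.Eventually.of_forall fun t => inv_nonneg.2 (Real.sqrt_nonneg _)
  have hinvI : IntegrableOn (fun t => (ρ t)⁻¹) (Icc 0 T) :=
    (lintegral_ofReal_ne_top_iff_integrable hρm.inv.aestronglyMeasurable hinvnn).1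
      (hLeq ▸ hLtop)
  rw [hsplit, hLeq, ← ofReal_integral_eq_lintegral_ofReal hinvI hinvnn,
    ← ENNReal.ofReal_mul halpha.le, ← ENNReal.ofReal_add
      (integral_nonneg fun t => by positivity)
      (mul_nonneg halpha.le (integral_nonneg fun t => inv_nonneg.2 (Real.sqrt_nonneg _)))]
  refine ENNReal.ofReal_le_ofReal ?_
  have hang : x 0 * x T + y 0 * y T = ρ 0 * ρ T * cos θ := by
    have := hp
    rw [inGamma, hrρ 0 h0mem, hrρ T hTmem, hr 0 h0mem, hr T hTmem] at this
    exact this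
  have key := angle_sq_mul_le (ρ := ρ) hθ0 hθ1 hT hu hw
    ((intervalIntegrable_iff_integrableOn_Icc_of_le hT.le).2
      (by simpa only [enorm2_sq] using p.hL2))
    (fun t => rfl) (fun t => rfl) (fun t => rfl)
    ((intervalIntegrable_iff_integrableOn_Icc_of_le hT.le).2 hinvI)
    (by
      rw [uIcc_of_le hT.le, ← ae_restrict_iff' measurableSet_Icc]
      filter_upwards [hpos] with t ht using ht.ne') hang
  simp only [intervalIntegral.integral_of_le hT.le, ← integral_Icc_eq_integral_Ioc] at key
  simp only [enorm2_sq, integral_const_mul]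
  have hS0 : 0 ≤ ∫ t in Icc 0 T, (ρ t)⁻¹ :=
    integral_nonneg fun t => inv_nonneg.2 (Real.sqrt_nonneg _)
  set S := ∫ t in Icc 0 T, (ρ t)⁻¹
  set E := ∫ t in Icc 0 T, ((p.v t).1 ^ 2 + (p.v t).2 ^ 2)
  obtain ⟨B, hB⟩ : ∃ B, B = (mu * alpha^2 * θ^2 * T) ^ ((1:ℝ)/3) := ⟨_, rfl⟩
  have hB0 : 0 < B := by rw [hB]; positivity
  have hB3 : B ^ 3 = mu * alpha^2 * θ^2 * T := by
    rw [hB, ← Real.rpow_natCast, ← Real.rpow_mul (by positivity)]; norm_num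
  rw [← hB]
  have hSpos : 0 < S := by
    refine lt_of_le_of_ne hS0 fun h => ?_
    rw [← h] at key
    have : 0 < θ ^ 2 * T := by positivity
    linarith
  have hq : B ^ 3 ≤ (alpha * S) ^ 2 * (mu * E) := by
    rw [hB3]
    have := mul_le_mul_of_nonneg_left key (by positivity : 0 ≤ mu * alpha ^ 2)
    linarith
  have hqpos : 0 < alpha * S := by positivity
  set q := alpha * S
  have h1 : 3 / 2 * B * q ^ 2 ≤ (mu / 2 * E + q) * q ^ 2 := by
    nlinarith [mul_nonneg (sq_nonneg (q - B)) (by positivity : 0 ≤ 2 * q + B)]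
  exact le_of_mul_le_mul_right h1 (by positivity)

/-- Uniform motion with angular speed `ω` on the circle of radius `R`. -/
def circularPath (R ω T : ℝ) : H1PathK T where
  r t := (R * cos (ω * t), R * sin (ω * t))
  v t := (-(R * ω * sin (ω * t)), R * ω * cos (ω * t))
  hvInt := Continuous.integrableOn_Icc (by fun_prop)
  hrep t _ := by
    rw [intervalIntegral.integral_eq_sub_of_hasDerivAt
      (f := fun t => (R * cos (ω * t), R * sin (ω * t))) (fun s _ => ?_)
      (Continuous.intervalIntegrable (by fun_prop) _ _)]
    · abel
    · have hlin : HasDerivAt (fun s => ω * s) ω s := by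
        simpa using (hasDerivAt_id s).const_mul ω
      refine ((hlin.cos.const_mul R).prodMk (hlin.sin.const_mul R)).congr_deriv ?_
      ext <;> simp <;> ring
  hL2 := Continuous.integrableOn_Icc (by unfold enorm2; fun_prop)

lemma inGamma_circularPath {R θ T : ℝ} (hR : 0 < R) (hT : 0 < T) :
    inGamma T θ (circularPath R (θ / T) T) := by
  have hθ : θ / T * T = θ := div_mul_cancel₀ θ hT.ne'
  have h1 : √((R * cos θ) ^ 2 + (R * sin θ) ^ 2) = R := by
    rw [Real.sqrt_eq_iff_mul_self_eq (by positivity) hR.le]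
    linear_combination R ^ 2 * Real.sin_sq_add_cos_sq θ
  have h2 : √(R ^ 2) = R := Real.sqrt_sq hR.le
  simp only [inGamma, circularPath, enorm2, hθ, mul_zero, cos_zero, sin_zero, h1]
  simp [h2]
  ring

lemma keplerAction_circularPath {R ω T mu alpha : ℝ} (hR : 0 < R) (hT : 0 < T) (hmu : 0 < mu)
    (halpha : 0 < alpha) :
    keplerAction mu alpha T (circularPath R ω T)
      = ENNReal.ofReal ((mu / 2 * (R * ω) ^ 2 + alpha / R) * T) := by
  have hr : ∀ t, enorm2 ((circularPath R ω T).r t) = R := fun t => by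
    simp only [circularPath, enorm2]
    rw [Real.sqrt_eq_iff_mul_self_eq (by positivity) hR.le]
    linear_combination R ^ 2 * Real.sin_sq_add_cos_sq (ω * t)
  have hv : ∀ t, enorm2 ((circularPath R ω T).v t) ^ 2 = (R * ω) ^ 2 := fun t => by
    rw [enorm2_sq]
    simp only [circularPath]
    linear_combination (R * ω) ^ 2 * Real.sin_sq_add_cos_sq (ω * t)
  simp only [keplerAction, hr, hv, lintegral_const, MeasurableSet.univ, Measure.restrict_apply,
    univ_inter, Real.volume_Icc, sub_zero]
  rw [← ENNReal.ofReal_inv_of_pos hR, ← ENNReal.ofReal_mul halpha.le,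
    ← ENNReal.ofReal_add (by positivity) (by positivity), ← ENNReal.ofReal_mul (by positivity),
    div_eq_mul_inv alpha]

end KeplerAngle

/-- `inf { I_{μ,α,T}(r) : r ∈ Γ_{T,θ} } = (3/2)(μα²θ²T)^{1/3}`. -/
theorem statement9 (θ T mu alpha : ℝ) (hθ0 : 0 < θ) (hθ1 : θ ≤ π)
    (hT : 0 < T) (hmu : 0 < mu) (halpha : 0 < alpha) :
    (⨅ (p : H1PathK T) (_ : inGamma T θ p), keplerAction mu alpha T p)
      = ENNReal.ofReal ((3/2) * (mu * alpha^2 * θ^2 * T) ^ ((1:ℝ)/3)) := by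
  refine le_antisymm ?_
    (le_iInf₂ fun p hp => KeplerAngle.le_keplerAction hθ0 hθ1 hT hmu halpha p hp)
  obtain ⟨B, hB⟩ : ∃ B, B = (mu * alpha^2 * θ^2 * T) ^ ((1:ℝ)/3) := ⟨_, rfl⟩
  have hB0 : 0 < B := by rw [hB]; positivity
  have hB3 : B ^ 3 = mu * alpha^2 * θ^2 * T := by
    rw [hB, ← Real.rpow_natCast, ← Real.rpow_mul (by positivity)]; norm_num
  have hR : 0 < alpha * T / B := by positivity
  refine (iInf₂_le _ (KeplerAngle.inGamma_circularPath hR hT)).trans (le_of_eq ?_)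
  rw [KeplerAngle.keplerAction_circularPath hR hT hmu halpha, ← hB]
  congr 1
  have h1 : mu / 2 * (alpha * T / B * (θ / T)) ^ 2 * T = B / 2 := by
    have : mu / 2 * (alpha * T / B * (θ / T)) ^ 2 * T = mu * alpha^2 * θ^2 * T / (2 * B ^ 2) := by
      field_simp
    rw [this, ← hB3]
    field_simp
  have h2 : alpha / (alpha * T / B) * T = B := by field_simp
  linarith

end
end
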